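/- For n ≥ 1, the number of stochastically recurrent configurations on the complete bipartite graph K_{2,n} with sink v_0 is |Sto(K_{2,n})| = n · 2^{n−1}. Equivalently, Σ_{k=0}^{n-1} Σ_{i=0}^{k} C(n,i) = n · 2^{n−1}. -/

import Mathlib

/-!
STATEMENT 4. Model of `K_{2,n}` as before: left part `Fin 2` (index `0` is the
sink `v_0`, index `1` is `v_1`, of degree `n`), right part `Fin n` (vertices
`v_2, ..., v_{n+1}`, each of degree `2`).  An orientation is
`O : Fin 2 → Fin n → Bool` (`true` = directed from left to right).  A stable
configuration is `p : Fin n × (Fin n → Fin 2)` (`p.1` = grains on `v_1`,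
`p.2 j` = grains on `v_{j+2}`; the types enforce stability).  `p` is
stochastically recurrent iff `in_O(v) ≥ d(v) - c(v)` for all non-sink `v`,
for some orientation `O`.

The theorem: `|Sto(K_{2,n})| = n · 2^(n-1)`, and equivalently
`∑_{k=0}^{n-1} ∑_{i=0}^{k} C(n,i) = n · 2^(n-1)`.
-/

/-- The row sum of binomial coefficients splits at any index, by the symmetry of the row. -/
theorem sum_range_choose_add_sum_range_choose_of_lt {n k : ℕ} (hk : k < n) :
    ∑ i ∈ Finset.range (k + 1), n.choose i + ∑ i ∈ Finset.range (n - k), n.choose i = 2 ^ n := by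
  have hsplit := Finset.sum_range_add (fun i => n.choose i) (k + 1) (n - k)
  rw [show k + 1 + (n - k) = n + 1 by omega, Nat.sum_range_choose] at hsplit
  rw [hsplit, ← Finset.sum_range_reflect (fun i => n.choose i) (n - k)]
  congr 1
  refine Finset.sum_congr rfl fun i hi => ?_
  have hi' := Finset.mem_range.mp hi
  exact Nat.choose_symm_of_eq_add (by omega)

theorem sum_range_sum_range_choose {n : ℕ} (hn : 1 ≤ n) :
    ∑ k ∈ Finset.range n, ∑ i ∈ Finset.range (k + 1), n.choose i = n * 2 ^ (n - 1) := by
  have hreflect := Finset.sum_range_reflect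
    (fun k => ∑ i ∈ Finset.range (k + 1), n.choose i) n
  have hsum : ∑ k ∈ Finset.range n, (∑ i ∈ Finset.range (k + 1), n.choose i +
      ∑ i ∈ Finset.range (n - 1 - k + 1), n.choose i) = n * 2 ^ n := by
    rw [Finset.sum_congr rfl (g := fun _ => 2 ^ n), Finset.sum_const, Finset.card_range,
      smul_eq_mul]
    intro k hk
    have hk' := Finset.mem_range.mp hk
    rw [show n - 1 - k + 1 = n - k by omega]
    exact sum_range_choose_add_sum_range_choose_of_lt hk'
  rw [Finset.sum_add_distrib, hreflect] at hsum
  obtain ⟨m, rfl⟩ := Nat.exists_eq_add_of_le' hn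
  rw [pow_succ, ← mul_assoc] at hsum
  rw [Nat.add_sub_cancel]
  omega

/-- The total number of ones in all binary words of length `n`. -/
theorem sum_card_filter_eq_one {n : ℕ} (hn : 1 ≤ n) :
    ∑ x : Fin n → Fin 2, (Finset.univ.filter fun j => x j = 1).card = n * 2 ^ (n - 1) := by
  have hswap : ∑ x : Fin n → Fin 2, (Finset.univ.filter fun j => x j = 1).card =
      ∑ x : Fin n → Fin 2, (Finset.univ.filter fun j => ¬ x j = 1).card := by
    refine Fintype.sum_equiv ((Equiv.refl _).arrowCongr (Equiv.swap 0 1)) _ _ fun x => ?_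
    congr 1
    refine Finset.filter_congr fun j _ => ?_
    have h : ∀ a : Fin 2, a = 1 ↔ ¬ Equiv.swap (0 : Fin 2) 1 a = 1 := by decide
    exact h (x j)
  have hsum : ∑ x : Fin n → Fin 2, ((Finset.univ.filter fun j => x j = 1).card +
      (Finset.univ.filter fun j => ¬ x j = 1).card) = n * 2 ^ n := by
    simp only [Finset.card_filter_add_card_filter_not]
    simp [mul_comm]
  rw [Finset.sum_add_distrib, ← hswap] at hsum
  obtain ⟨m, rfl⟩ := Nat.exists_eq_add_of_le' hn
  rw [pow_succ, ← mul_assoc] at hsum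
  rw [Nat.add_sub_cancel]
  omega

/-- A compatible orientation exists iff `v_1` can be fed by the right vertices holding a grain. -/
theorem exists_orientation_iff {n : ℕ} (c : ℕ) (x : Fin n → Fin 2) :
    (∃ O : Fin 2 → Fin n → Bool,
      n - c ≤ (Finset.univ.filter fun j : Fin n => O 1 j = false).card ∧
      ∀ j : Fin n,
        2 - (x j : ℕ) ≤ (Finset.univ.filter fun i : Fin 2 => O i j = true).card) ↔
    n - c ≤ (Finset.univ.filter fun j => x j = 1).card := by
  have hlocal : ∀ (a : Fin 2) (f : Fin 2 → Bool),
      2 - (a : ℕ) ≤ (Finset.univ.filter fun i : Fin 2 => f i = true).card →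
        f 1 = false → a = 1 := by decide
  have hfeed : ∀ a : Fin 2, 2 - (a : ℕ) ≤
      (Finset.univ.filter fun i : Fin 2 => (decide (i = 0) || decide (a ≠ 1)) = true).card := by
    decide
  constructor
  · rintro ⟨O, hc, hO⟩
    exact hc.trans <| Finset.card_le_card <| Finset.monotone_filter_right _
      fun j _ hj => hlocal (x j) (fun i => O i j) (hO j) hj
  · intro h
    refine ⟨fun i j => decide (i = 0) || decide (x j ≠ 1), ?_, fun j => hfeed (x j)⟩
    simpa using h

theorem card_filter_sub_le {n s : ℕ} (hs : s ≤ n) :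
    (Finset.univ.filter fun c : Fin n => n - (c : ℕ) ≤ s).card = s := by
  let e : {c : Fin n // n - (c : ℕ) ≤ s} ≃ Fin s :=
    { toFun := fun c => ⟨n - 1 - (c.1 : ℕ), by omega⟩
      invFun := fun k => ⟨⟨n - 1 - (k : ℕ), by omega⟩, by dsimp only; omega⟩
      left_inv := fun c => by
        ext
        dsimp only
        omega
      right_inv := fun k => by
        ext
        dsimp only
        omega }
  rw [← Fintype.card_subtype, Fintype.card_congr e, Fintype.card_fin]

theorem card_sto_K2n (n : ℕ) (hn : 1 ≤ n) :
    ((Finset.univ : Finset (Fin n × (Fin n → Fin 2))).filter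
        (fun p => ∃ O : Fin 2 → Fin n → Bool,
          n - (p.1 : ℕ) ≤ (Finset.univ.filter fun j : Fin n => O 1 j = false).card ∧
          ∀ j : Fin n,
            2 - (p.2 j : ℕ) ≤ (Finset.univ.filter fun i : Fin 2 => O i j = true).card)).card
      = n * 2 ^ (n - 1) ∧
    ∑ k ∈ Finset.range n, ∑ i ∈ Finset.range (k + 1), n.choose i = n * 2 ^ (n - 1) := by
  refine ⟨?_, sum_range_sum_range_choose hn⟩
  simp only [exists_orientation_iff]
  rw [← sum_card_filter_eq_one hn, Finset.card_filter, Fintype.sum_prod_type_right]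
  refine Finset.sum_congr rfl fun x _ => ?_
  rw [← Finset.card_filter]
  exact card_filter_sub_le (s := (Finset.univ.filter fun j => x j = 1).card)
    ((Finset.card_le_univ _).trans_eq (Fintype.card_fin n))
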